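/- Let m ≥ 4 be even, n ≥ 3 be odd, and let s be an integer whose multiplicative order modulo n equals 2 (so s^m ≡ 1 (mod n) and s ≢ 1 (mod n)). If lcm(m/2, n) ≥ m + n − 1, then d(G_{m,n,s}) ≥ lcm(m/2, n) > m + n − 2; in particular it is not the case that both d(G_{m,n,s}) = m + n − 2 and E(G_{m,n,s}) = mn + m + n − 2. -/

import Mathlib

/-- A sequence (multiset) over a group is *product-one* if its terms can be
ordered so that their product is `1`. -/
def IsProductOne {G : Type*} [Group G] (S : Multiset G) : Prop :=
  ∃ l : List G, (l : Multiset G) = S ∧ l.prod = 1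

/-- A sequence is *product-one free* if no nonempty subsequence is product-one. -/
def ProductOneFree {G : Type*} [Group G] (S : Multiset G) : Prop :=
  ∀ T : Multiset G, T ≤ S → T ≠ 0 → ¬ IsProductOne T

/-- The small Davenport constant: maximal length of a product-one free sequence. -/
noncomputable def smallDavenport (G : Type*) [Group G] : ℕ :=
  sSup {k : ℕ | ∃ S : Multiset G, Multiset.card S = k ∧ ProductOneFree S}

/-- The Gao constant: the least `ℓ > 0` such that every sequence of length at least `ℓ`
contains a product-one subsequence of length `|G|`. -/
noncomputable def gaoConstant (G : Type*) [Group G] : ℕ :=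
  sInf {ℓ : ℕ | 0 < ℓ ∧ ∀ S : Multiset G, ℓ ≤ Multiset.card S →
    ∃ T : Multiset G, T ≤ S ∧ Multiset.card T = Nat.card G ∧ IsProductOne T}

/-- Relations of the metacyclic group `⟨x, y ∣ x^m = y^n = 1, y*x = x*y^s⟩`. -/
def metacyclicRels (m n : ℕ) (s : ℤ) : Set (FreeGroup (Fin 2)) :=
  {FreeGroup.of 0 ^ m, FreeGroup.of 1 ^ n,
    FreeGroup.of 1 * FreeGroup.of 0 * (FreeGroup.of 0 * FreeGroup.of 1 ^ s)⁻¹}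

/-- The metacyclic group `G_{m,n,s} = Cₙ ⋊ₛ Cₘ = ⟨x, y ∣ x^m = y^n = 1, y*x = x*y^s⟩`. -/
abbrev Metacyclic (m n : ℕ) (s : ℤ) : Type := PresentedGroup (metacyclicRels m n s)

/-- The generator `x` of `G_{m,n,s}`. -/
def mcX (m n : ℕ) (s : ℤ) : Metacyclic m n s := PresentedGroup.of 0

/-- The generator `y` of `G_{m,n,s}`. -/
def mcY (m n : ℕ) (s : ℤ) : Metacyclic m n s := PresentedGroup.of 1

theorem mc_x_pow (m n : ℕ) (s : ℤ) : mcX m n s ^ m = 1 := by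
  have h := PresentedGroup.one_of_mem (rels := metacyclicRels m n s)
    (x := FreeGroup.of 0 ^ m) (by simp [metacyclicRels])
  simpa [mcX, PresentedGroup.of] using h

theorem mc_y_pow (m n : ℕ) (s : ℤ) : mcY m n s ^ n = 1 := by
  have h := PresentedGroup.one_of_mem (rels := metacyclicRels m n s)
    (x := FreeGroup.of 1 ^ n) (by simp [metacyclicRels])
  simpa [mcY, PresentedGroup.of] using h

theorem mc_comm (m n : ℕ) (s : ℤ) :
    mcY m n s * mcX m n s = mcX m n s * mcY m n s ^ s := by
  have h := PresentedGroup.one_of_mem (rels := metacyclicRels m n s)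
    (x := FreeGroup.of 1 * FreeGroup.of 0 * (FreeGroup.of 0 * FreeGroup.of 1 ^ s)⁻¹)
    (by simp [metacyclicRels])
  rw [map_mul, map_inv, mul_inv_eq_one, map_mul, map_mul, map_zpow] at h
  exact h

theorem mc_comm1 (m n : ℕ) (s k : ℤ) :
    mcY m n s ^ k * mcX m n s = mcX m n s * mcY m n s ^ (s * k) := by
  have h : SemiconjBy (mcX m n s) (mcY m n s ^ s) (mcY m n s) := (mc_comm m n s).symm
  have := h.zpow_right k
  rw [← zpow_mul] at this
  exact this.symm

theorem mc_comm2 (m n : ℕ) (s k : ℤ) (i : ℕ) :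
    mcY m n s ^ k * mcX m n s ^ i = mcX m n s ^ i * mcY m n s ^ (s ^ i * k) := by
  induction i with
  | zero => simp
  | succ i ih =>
    rw [pow_succ, ← mul_assoc, ih, mul_assoc, mc_comm1, ← mul_assoc]
    congr 2
    ring

theorem mc_form (m n : ℕ) (s : ℤ) (hm : 4 ≤ m) (g : Metacyclic m n s) :
    ∃ (i : ℕ) (j : ℤ), g = mcX m n s ^ i * mcY m n s ^ j := by
  have hg : g ∈ Subgroup.closure (Set.range (PresentedGroup.of (rels := metacyclicRels m n s))) := by
    rw [PresentedGroup.closure_range_of]; trivial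
  induction hg using Subgroup.closure_induction with
  | mem a ha =>
    obtain ⟨t, rfl⟩ := ha
    fin_cases t
    · exact ⟨1, 0, by simp [mcX]⟩
    · exact ⟨0, 1, by simp [mcY]⟩
  | one => exact ⟨0, 0, by simp⟩
  | mul a b _ _ ha hb =>
    obtain ⟨i, j, rfl⟩ := ha
    obtain ⟨i', j', rfl⟩ := hb
    refine ⟨i + i', s ^ i' * j + j', ?_⟩
    rw [pow_add, zpow_add, mul_assoc, ← mul_assoc (mcY m n s ^ j), mc_comm2]
    simp only [mul_assoc]
  | inv a _ ha =>
    obtain ⟨i, j, rfl⟩ := ha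
    have hx : (mcX m n s)⁻¹ = mcX m n s ^ (m - 1) := by
      rw [inv_eq_iff_mul_eq_one, ← pow_succ', Nat.sub_add_cancel (by omega), mc_x_pow]
    refine ⟨(m - 1) * i, s ^ ((m - 1) * i) * (-j), ?_⟩
    rw [← mc_comm2, mul_inv_rev, ← inv_pow, hx, zpow_neg, pow_mul]

theorem mc_finite (m n : ℕ) (s : ℤ) (hm : 4 ≤ m) (hn : 3 ≤ n) : Finite (Metacyclic m n s) := by
  rw [← Set.finite_univ_iff]
  have hx : IsOfFinOrder (mcX m n s) :=
    isOfFinOrder_iff_pow_eq_one.2 ⟨m, by omega, mc_x_pow m n s⟩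
  have hy : IsOfFinOrder (mcY m n s) :=
    isOfFinOrder_iff_pow_eq_one.2 ⟨n, by omega, mc_y_pow m n s⟩
  have h1 : (Submonoid.powers (mcX m n s) : Set (Metacyclic m n s)).Finite :=
    finite_powers.2 hx
  have h2 : (Subgroup.zpowers (mcY m n s) : Set (Metacyclic m n s)).Finite :=
    finite_zpowers.2 hy
  refine (Set.Finite.image2 (fun a b => a * b) h1 h2).subset ?_
  intro g _
  obtain ⟨i, j, rfl⟩ := mc_form m n s hm g
  exact ⟨_, ⟨i, rfl⟩, _, ⟨j, rfl⟩, rfl⟩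

theorem davenport_bdd (G : Type*) [Group G] [Finite G] :
    BddAbove {k : ℕ | ∃ S : Multiset G, Multiset.card S = k ∧ ProductOneFree S} := by
  classical
  haveI := Fintype.ofFinite G
  refine ⟨∑ g : G, orderOf g, ?_⟩
  rintro k ⟨S, rfl, hS⟩
  rw [← Multiset.sum_count_eq_card (s := Finset.univ) (m := S) (fun a _ => Finset.mem_univ a)]
  refine Finset.sum_le_sum fun g _ => ?_
  by_contra! h
  refine hS (Multiset.replicate (orderOf g) g) (Multiset.le_count_iff_replicate_le.1 h.le) ?_
    ⟨List.replicate (orderOf g) g, Multiset.coe_replicate _ _, by simp [pow_orderOf_eq_one]⟩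
  intro h0
  have := congrArg Multiset.card h0
  rw [Multiset.card_replicate, Multiset.card_zero] at this
  exact (orderOf_pos g).ne' this

/-- The map to the cyclic group of order m. -/
theorem mc_homA (m n : ℕ) (s : ℤ) :
    ∃ f : Metacyclic m n s →* Multiplicative (ZMod m),
      f (mcX m n s) = Multiplicative.ofAdd 1 ∧ f (mcY m n s) = 1 := by
  let g : Fin 2 → Multiplicative (ZMod m) := ![Multiplicative.ofAdd 1, 1]
  have h : ∀ r ∈ metacyclicRels m n s, FreeGroup.lift g r = 1 := by
    intro r hr
    simp only [metacyclicRels, Set.mem_insert_iff, Set.mem_singleton_iff] at hr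
    rcases hr with rfl | rfl | rfl
    · simp [g, ← ofAdd_nsmul]
    · simp [g]
    · simp [g]
  exact ⟨PresentedGroup.toGroup h, by simp [mcX, g], by simp [mcY, g]⟩

theorem mc_homB (m n : ℕ) (s : ℤ) (hme : Even m) (hs : (s : ZMod n) * s = 1) :
    ∃ f : Metacyclic m n s →* Equiv.Perm (ZMod n),
      f (mcX m n s ^ 2 * mcY m n s) = Equiv.addLeft 1 := by
  let u : (ZMod n)ˣ := ⟨s, s, hs, hs⟩
  have hu : u ^ 2 = 1 := by ext; simp [u, pow_two, hs]
  let X : Equiv.Perm (ZMod n) := Units.mulLeft u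
  have hX : X ^ 2 = 1 := by
    ext z
    simp [X, u, pow_two, ← mul_assoc, hs]
  have hY : ∀ k : ℤ, (Equiv.addLeft (1 : ZMod n)) ^ k = Equiv.addLeft (k : ZMod n) := by
    intro k
    simp
  let g : Fin 2 → Equiv.Perm (ZMod n) := ![X, Equiv.addLeft 1]
  have h : ∀ r ∈ metacyclicRels m n s, FreeGroup.lift g r = 1 := by
    intro r hr
    simp only [metacyclicRels, Set.mem_insert_iff, Set.mem_singleton_iff] at hr
    rcases hr with rfl | rfl | rfl
    · obtain ⟨t, rfl⟩ := hme
      rw [← two_mul]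
      simp [g, pow_mul, hX]
    · have := hY n
      rw [zpow_natCast] at this
      simp only [g, map_pow, FreeGroup.lift_apply_of, Matrix.cons_val_one, Matrix.cons_val_fin_one]
      rw [this]; ext; simp
    · rw [map_mul, map_inv, mul_inv_eq_one, map_mul, map_mul, map_zpow]
      simp only [g, FreeGroup.lift_apply_of, Matrix.cons_val_one, Matrix.cons_val_fin_one, Matrix.cons_val_zero]
      rw [hY]
      ext z
      simp [X, u, mul_add, hs]
  refine ⟨PresentedGroup.toGroup h, ?_⟩
  rw [map_mul, map_pow]
  simp [mcX, mcY, g, hX]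

theorem mc_free (m n : ℕ) (s : ℤ) (hm : 4 ≤ m) (hme : Even m)
    (hn : 3 ≤ n) (hs : (s : ZMod n) * s = 1) :
    ProductOneFree (mcX m n s ::ₘ
      Multiset.replicate (Nat.lcm (m / 2) n - 1) (mcX m n s ^ 2 * mcY m n s)) := by
  obtain ⟨f, hfx, hfy⟩ := mc_homA m n s
  obtain ⟨F, hF⟩ := mc_homB m n s hme hs
  obtain ⟨t, rfl⟩ := hme
  have ht : (t + t) / 2 = t := by omega
  rw [ht]
  set g := mcX (t + t) n s ^ 2 * mcY (t + t) n s with hg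
  have hfg : f g = Multiplicative.ofAdd 2 := by
    rw [hg, map_mul, map_pow, hfx, hfy, mul_one, ← ofAdd_nsmul]; simp
  rintro T hT hT0 ⟨l, hl, hprod⟩
  by_cases hx : mcX (t + t) n s ∈ T
  · obtain ⟨T', rfl⟩ := Multiset.exists_cons_of_mem hx
    have hT' := (Multiset.cons_le_cons_iff _).1 hT
    obtain ⟨k, -, rfl⟩ := Multiset.le_replicate_iff.1 hT'
    have h1 : (Multiset.map f (l : Multiset (Metacyclic (t + t) n s))).prod = 1 := by
      rw [Multiset.map_coe, Multiset.prod_coe, ← map_list_prod, hprod, map_one]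
    rw [hl] at h1
    simp only [Multiset.map_cons, Multiset.map_replicate, Multiset.prod_cons,
      Multiset.prod_replicate, hfx, hfg] at h1
    rw [← ofAdd_nsmul, ← ofAdd_add] at h1
    have h2 : (1 : ZMod (t + t)) + k • 2 = 0 := h1
    have h3 : ((1 + k * 2 : ℕ) : ZMod (t + t)) = 0 := by
      rw [← h2]; push_cast; simp
    rw [ZMod.natCast_eq_zero_iff] at h3
    have : 2 ∣ 1 + k * 2 := dvd_trans ⟨t, by ring⟩ h3
    omega
  · have hT' := (Multiset.le_cons_of_notMem hx).1 hT
    obtain ⟨k, hk, rfl⟩ := Multiset.le_replicate_iff.1 hT'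
    have hl' : l = List.replicate k g := by
      rw [← Multiset.coe_replicate, Multiset.coe_eq_coe] at hl
      exact List.perm_replicate.1 hl
    rw [hl', List.prod_replicate] at hprod
    have hA : t ∣ k := by
      have h1 := congrArg f hprod
      rw [map_pow, hfg, ← ofAdd_nsmul, map_one] at h1
      have h2 : (k • 2 : ZMod (t + t)) = 0 := h1
      have h3 : ((k * 2 : ℕ) : ZMod (t + t)) = 0 := by
        rw [← h2]; push_cast; simp
      rw [ZMod.natCast_eq_zero_iff, ← mul_two] at h3
      exact Nat.dvd_of_mul_dvd_mul_right (by norm_num) h3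
    have hB : n ∣ k := by
      have h1 := congrArg F hprod
      rw [map_pow, hF, map_one] at h1
      have h2 := congrArg (fun e : Equiv.Perm (ZMod n) => e 0) h1
      rw [← ZMod.natCast_eq_zero_iff]
      simpa using h2
    have hL := Nat.lcm_dvd hA hB
    have hk0 : 0 < k := by
      rcases Nat.eq_zero_or_pos k with rfl | h
      · simp at hT0
      · exact h
    have := Nat.le_of_dvd hk0 hL
    have := Nat.lcm_pos (m := t) (n := n) (by omega) (by omega)
    omega

theorem bass_fails_of_lcm_large (m n : ℕ) (s : ℤ) (hm : 4 ≤ m) (hme : Even m)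
    (hn : 3 ≤ n) (hno : Odd n) (hord : orderOf (s : ZMod n) = 2)
    (hlcm : m + n - 1 ≤ Nat.lcm (m / 2) n) :
    Nat.lcm (m / 2) n ≤ smallDavenport (Metacyclic m n s) ∧
    m + n - 2 < Nat.lcm (m / 2) n ∧
    ¬ (smallDavenport (Metacyclic m n s) = m + n - 2 ∧
       gaoConstant (Metacyclic m n s) = m * n + m + n - 2) := by
  have hs : (s : ZMod n) * s = 1 := by
    rw [← pow_two, ← hord, pow_orderOf_eq_one]
  haveI := mc_finite m n s hm hn
  have h1 : Nat.lcm (m / 2) n ≤ smallDavenport (Metacyclic m n s) := by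
    refine le_csSup (davenport_bdd _) ⟨_, ?_, mc_free m n s hm hme hn hs⟩
    rw [Multiset.card_cons, Multiset.card_replicate]
    omega
  refine ⟨h1, by omega, ?_⟩
  rintro ⟨h2, -⟩
  omega
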